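/- Let n ≥ 1 and let J : ℝ^{2n} → M_{2n}(ℝ) be an orthogonal complex structure of class C¹ on ℝ^{2n}, i.e. J(x)ᵀJ(x) = I and J(x)² = −I for every x, and the Nijenhuis tensor N_J vanishes identically. Suppose J is asymptotically constant: there exists a constant matrix J₀ with J₀ᵀJ₀ = I and J₀² = −I such that ‖J(x) − J₀‖ → 0 as ‖x‖ → ∞. Then J is constant: J(x) = J₀ for all x ∈ ℝ^{2n}. -/

import Mathlib

open Matrix Filter

attribute [local instance] Matrix.normedAddCommGroup Matrix.normedSpace

/-- The Nijenhuis tensor of a matrix-valued map `J` (an almost complex structure),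
`N_J(x)(v,w) = (∂_{J(x)v}J)(x)·w − (∂_{J(x)w}J)(x)·v + J(x)·((∂_wJ)(x)·v) − J(x)·((∂_vJ)(x)·w)`. -/
noncomputable def nijenhuis {ι : Type*} [Fintype ι]
    (J : (ι → ℝ) → Matrix ι ι ℝ) (x v w : ι → ℝ) : ι → ℝ :=
  (fderiv ℝ J x ((J x).mulVec v)).mulVec w
    - (fderiv ℝ J x ((J x).mulVec w)).mulVec v
    + (J x).mulVec ((fderiv ℝ J x w).mulVec v)
    - (J x).mulVec ((fderiv ℝ J x v).mulVec w)

theorem exists_quadratic_remainder {H : Type*} [NormedAddCommGroup H] [NormedSpace ℂ H]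
    {g : ℂ → H} (hg : AnalyticAt ℂ g 0) :
    ∃ R : ℂ → H, ContinuousAt R 0 ∧ ∀ t, g t = (g 0 + t • deriv g 0) + t ^ 2 • R t := by
  obtain ⟨p, hp⟩ := hg
  refine ⟨dslope (dslope g 0) 0, ?_, fun t => ?_⟩
  · exact (hp.has_fpower_series_dslope_fslope.has_fpower_series_dslope_fslope).analyticAt.continuousAt
  · have h1 := sub_smul_dslope g 0 t
    have h2 := sub_smul_dslope (dslope g 0) 0 t
    rw [sub_zero] at h1 h2
    rw [dslope_same] at h2
    rw [pow_two, mul_smul, h2, smul_sub, h1]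
    abel

/-- The second-order term of `‖g‖²` averaged over the four directions `±1, ±i`. -/
theorem tendsto_four_point_laplacian {H : Type*} [NormedAddCommGroup H] [InnerProductSpace ℂ H]
    {g : ℂ → H} (hg : AnalyticAt ℂ g 0) :
    Tendsto (fun r : ℝ => (‖g r‖ ^ 2 + ‖g (-r)‖ ^ 2 + ‖g (r * Complex.I)‖ ^ 2
      + ‖g (-(r * Complex.I))‖ ^ 2 - 4 * ‖g 0‖ ^ 2) / r ^ 2)
      (nhdsWithin 0 {0}ᶜ) (nhds (4 * ‖deriv g 0‖ ^ 2)) := by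
  obtain ⟨R, hR, hgR⟩ := exists_quadratic_remainder hg
  set a := g 0
  set b := deriv g 0
  have hexp : ∀ (t : ℂ) (s : ℝ), t ^ 2 = (s : ℂ) → ‖g t‖ ^ 2 = ‖a + t • b‖ ^ 2
      + s * (2 * RCLike.re (inner ℂ (a + t • b) (R t)) + s * ‖R t‖ ^ 2) := by
    intro t s hs
    rw [hgR t, hs, @norm_add_sq ℂ, inner_smul_right, norm_smul, mul_pow]
    have : ‖(s : ℂ)‖ ^ 2 = s ^ 2 := by rw [Complex.norm_real]; simp
    rw [this, RCLike.re_to_complex, Complex.re_ofReal_mul, ← RCLike.re_to_complex]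
    ring
  have hpar : ∀ t : ℂ, ‖a + t • b‖ ^ 2 + ‖a + (-t) • b‖ ^ 2
      = 2 * (‖a‖ ^ 2 + ‖t‖ ^ 2 * ‖b‖ ^ 2) := by
    intro t
    have := parallelogram_law_with_norm ℂ a (t • b)
    rw [norm_smul] at this
    rw [neg_smul, ← sub_eq_add_neg]
    nlinarith
  let Q : ℂ → ℝ → ℝ := fun t s =>
    2 * RCLike.re (inner ℂ (a + t • b) (R t)) + s * ‖R t‖ ^ 2
  have hQ : ∀ (ω : ℂ) (ε : ℝ), Tendsto (fun r : ℝ => Q (r * ω) (ε * r ^ 2)) (nhds 0)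
      (nhds (2 * RCLike.re (inner ℂ a (R 0)))) := by
    intro ω ε
    have hc : ContinuousAt (fun r : ℝ => (r : ℂ) * ω) 0 := by fun_prop
    have hRc : ContinuousAt (fun r : ℝ => R (r * ω)) 0 := by
      apply ContinuousAt.comp (g := R) _ hc
      simpa using hR
    have : ContinuousAt (fun r : ℝ => Q (r * ω) (ε * r ^ 2)) 0 := by
      simp only [Q]
      refine ContinuousAt.add (continuousAt_const.mul ?_)
        (ContinuousAt.mul (by fun_prop) (hRc.norm.pow 2))
      exact RCLike.continuous_re.continuousAt.comp (ContinuousAt.inner (𝕜 := ℂ) (by fun_prop) hRc)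
    have h2 := this.tendsto
    simpa [Q] using h2
  have hlim := ((((hQ 1 1).add (hQ (-1) 1)).sub (hQ Complex.I (-1))).sub
    (hQ (-Complex.I) (-1))).const_add (4 * ‖b‖ ^ 2)
  refine Tendsto.congr' ?_ ((hlim.mono_left nhdsWithin_le_nhds).trans (by simp))
  filter_upwards [self_mem_nhdsWithin] with r hr
  have hr : r ≠ 0 := hr
  have e1 := hexp r (r ^ 2) (by push_cast; ring)
  have e2 := hexp (-r) (r ^ 2) (by push_cast; ring)
  have e3 := hexp (r * Complex.I) (-1 * r ^ 2) (by rw [mul_pow, Complex.I_sq]; push_cast; ring)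
  have e4 := hexp (-(r * Complex.I)) (-1 * r ^ 2) (by
    rw [neg_sq, mul_pow, Complex.I_sq]; push_cast; ring)
  have p1 := hpar r
  have p2 := hpar (r * Complex.I)
  have n1 : ‖(r : ℂ)‖ ^ 2 = r ^ 2 := by rw [Complex.norm_real]; simp
  have n2 : ‖(r : ℂ) * Complex.I‖ ^ 2 = r ^ 2 := by rw [norm_mul, Complex.norm_I, mul_one, n1]
  rw [n1] at p1
  rw [n2] at p2
  rw [eq_div_iff (pow_ne_zero 2 hr), e1, e2, e3, e4]
  simp only [Q, mul_one, mul_neg]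
  linear_combination -p1 - p2

/-- A superharmonic-type obstruction: `‖f‖² (1 - c / ‖g‖²)` has no local maximum at a zero of
`⟪g 0, g'⟫` where `g' ≠ 0`. -/
theorem not_isLocalMax_norm_sq_mul {H : Type*} [NormedAddCommGroup H] [InnerProductSpace ℂ H]
    {g : ℂ → H} {f : ℂ → ℂ} (hg : AnalyticAt ℂ g 0) (hf : AnalyticAt ℂ f 0) (hf0 : f 0 ≠ 0)
    (horth : inner ℂ (g 0) (deriv g 0) = 0) (hg' : deriv g 0 ≠ 0) {c : ℝ} (hc : 0 < c)
    (hcg : c < ‖g 0‖ ^ 2) :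
    ¬ IsLocalMax (fun t => ‖f t‖ ^ 2 * (1 - c / ‖g t‖ ^ 2)) 0 := by
  intro hmax
  set κ := 1 - c / ‖g 0‖ ^ 2 with hκ
  have hρ : 0 < ‖g 0‖ ^ 2 := hc.trans hcg
  have hκ0 : 0 < κ := by rw [hκ, sub_pos, div_lt_one hρ]; exact hcg
  have hκ1 : κ < 1 := by rw [hκ]; linarith [div_pos hc hρ]
  have hκc : (1 - κ) * ‖g 0‖ ^ 2 = c := by
    rw [hκ, sub_sub_cancel, div_mul_cancel₀ _ hρ.ne']
  let q : ℂ → ℂ := fun t => f 0 * (f t)⁻¹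
  have hq : AnalyticAt ℂ q 0 := analyticAt_const.mul (hf.inv hf0)
  have hq0 : q 0 = 1 := mul_inv_cancel₀ hf0
  let p : ℂ → H := fun t => q t • g t
  have hp : AnalyticAt ℂ p 0 := hq.smul hg
  have hp0 : p 0 = g 0 := by simp [p, hq0]
  have hp' : deriv p 0 = deriv g 0 + deriv q 0 • g 0 := by
    have := hq.differentiableAt.hasDerivAt.smul hg.differentiableAt.hasDerivAt
    rw [hq0, one_smul] at this
    exact this.deriv
  have hH : IsLocalMax (fun t => ‖g t‖ ^ 2 - κ * ‖p t‖ ^ 2) 0 := by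
    have hfne := hf.continuousAt.eventually_ne hf0
    have hgne := hg.continuousAt.eventually_ne
      (show g 0 ≠ 0 by intro h; rw [h] at hρ; simp at hρ)
    filter_upwards [hmax, hfne, hgne] with t ht hft hgt
    have hgt : 0 < ‖g t‖ ^ 2 := by positivity
    have hft : 0 < ‖f t‖ ^ 2 := by positivity
    have hpt : ‖p t‖ ^ 2 = ‖f 0‖ ^ 2 / ‖f t‖ ^ 2 * ‖g t‖ ^ 2 := by
      simp only [p, q, norm_smul, norm_mul, norm_inv]
      field_simp
    rw [hpt, hp0]
    simp only [← hκ] at ht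
    have h1 : ‖f t‖ ^ 2 * (‖g t‖ ^ 2 - c) ≤ ‖f 0‖ ^ 2 * κ * ‖g t‖ ^ 2 := by
      have := mul_le_mul_of_nonneg_right ht hgt.le
      have e : ‖f t‖ ^ 2 * (1 - c / ‖g t‖ ^ 2) * ‖g t‖ ^ 2 = ‖f t‖ ^ 2 * (‖g t‖ ^ 2 - c) := by
        field_simp
      linarith
    have h2 : ‖g t‖ ^ 2 - c ≤ ‖f 0‖ ^ 2 / ‖f t‖ ^ 2 * ‖g t‖ ^ 2 * κ := by
      have e : ‖f 0‖ ^ 2 / ‖f t‖ ^ 2 * ‖g t‖ ^ 2 * κ = ‖f 0‖ ^ 2 * κ * ‖g t‖ ^ 2 / ‖f t‖ ^ 2 := by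
        ring
      rw [e, le_div_iff₀ hft]; linarith
    linarith
  have hq' : deriv q 0 = 0 := by
    set ω : ℂ := (starRingEnd ℂ) (deriv q 0) with hω
    have hline : HasDerivAt (fun s : ℝ => (s : ℂ) * ω) ω 0 := by
      simpa using (Complex.ofRealCLM.hasDerivAt (x := (0 : ℝ))).mul_const ω
    have hcomp : ∀ {h : ℂ → H}, AnalyticAt ℂ h 0 →
        HasDerivAt (fun s : ℝ => h ((s : ℂ) * ω)) (ω • deriv h 0) 0 := by
      intro h hh
      have h1 : HasDerivAt h (deriv h 0) (((0 : ℝ) : ℂ) * ω) := by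
        simpa using hh.differentiableAt.hasDerivAt
      exact h1.scomp (0 : ℝ) hline
    let _ : InnerProductSpace ℝ H := InnerProductSpace.rclikeToReal ℂ H
    have hd := ((hcomp hg).norm_sq).sub (((hcomp hp).norm_sq).const_mul κ)
    have hm : IsLocalMax (fun s : ℝ => ‖g (s * ω)‖ ^ 2 - κ * ‖p (s * ω)‖ ^ 2) 0 := by
      have := hline.continuousAt
      have h3 : Tendsto (fun s : ℝ => (s : ℂ) * ω) (nhds 0) (nhds 0) := by
        simpa using this.tendsto
      filter_upwards [h3.eventually hH] with s hs
      simpa using hs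
    have := hm.hasDerivAt_eq_zero hd
    simp only [Complex.ofReal_zero, zero_mul, real_inner_eq_re_inner ℂ, hp0, hp', smul_add,
      inner_add_right, inner_smul_right, horth] at this
    have h4 : ω * (deriv q 0 * inner ℂ (g 0) (g 0)) = ((‖deriv q 0‖ ^ 2 * ‖g 0‖ ^ 2 : ℝ) : ℂ) := by
      rw [← mul_assoc, hω, Complex.conj_mul', inner_self_eq_norm_sq_to_K]; push_cast; rfl
    rw [h4] at this
    simp only [mul_zero, zero_add, RCLike.re_to_complex, Complex.ofReal_re, Complex.zero_re] at this
    have h5 : ‖deriv q 0‖ ^ 2 = 0 := by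
      have : ‖deriv q 0‖ ^ 2 * (κ * ‖g 0‖ ^ 2) = 0 := by linarith
      rcases mul_eq_zero.1 this with h | h
      · exact h
      · exact absurd h (by positivity)
    simpa using h5
  have hp1 : deriv p 0 = deriv g 0 := by rw [hp', hq']; simp
  have hlim := (tendsto_four_point_laplacian hg).sub ((tendsto_four_point_laplacian hp).const_mul κ)
  rw [hp1, hp0] at hlim
  have hle := le_of_tendsto (b := (0 : ℝ)) hlim (by
    have hev : ∀ ω : ℂ, ∀ᶠ r : ℝ in nhds 0, ‖g (r * ω)‖ ^ 2 - κ * ‖p (r * ω)‖ ^ 2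
        ≤ ‖g 0‖ ^ 2 - κ * ‖g 0‖ ^ 2 := by
      intro ω
      have hc : ContinuousAt (fun r : ℝ => (r : ℂ) * ω) 0 := by fun_prop
      have h3 : Tendsto (fun s : ℝ => (s : ℂ) * ω) (nhds 0) (nhds 0) := by
        simpa using hc.tendsto
      filter_upwards [h3.eventually hH] with s hs
      simpa [hp0] using hs
    refine nhdsWithin_le_nhds ?_
    filter_upwards [hev 1, hev (-1), hev Complex.I, hev (-Complex.I)] with r h1 h2 h3 h4
    simp only [mul_one, mul_neg] at h1 h2 h3 h4
    rw [mul_div_assoc', ← sub_div]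
    apply div_nonpos_of_nonpos_of_nonneg _ (sq_nonneg r)
    linarith)
  have : 0 < ‖deriv g 0‖ ^ 2 := by positivity
  nlinarith

section IntegrableFields

variable {E F : Type*} [NormedAddCommGroup E] [NormedSpace ℝ E]
  [NormedAddCommGroup F] [NormedSpace ℝ F] [NormedSpace ℂ F]

/-- A `C¹` field of complex structures satisfying `∂_{Kv} K = K ∂_v K`. For orthogonal fields this
is equivalent to the vanishing of the Nijenhuis tensor. -/
structure IsHermitianIntegrable (K : E → E →L[ℝ] E) : Prop where
  contDiff : ContDiff ℝ 1 K
  sq : ∀ x, K x * K x = -1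
  fderiv_apply : ∀ x v, fderiv ℝ K x (K x v) = K x * fderiv ℝ K x v

/-- The inverse of `K + K₀`, which is a Cayley-type coordinate on complex structures. -/
noncomputable def cayley (K : E → E →L[ℝ] E) (K₀ : E →L[ℝ] E) (x : E) : E →L[ℝ] E :=
  Ring.inverse (K x + K₀)

/-- The real affine parametrisation of the `K₀`-complex line through `q` in direction `u`. -/
noncomputable def complexLine (K₀ : E →L[ℝ] E) (q u : E) (t : ℂ) : E :=
  q + (t.re • u + t.im • K₀ u)

theorem hasFDerivAt_complexLine (K₀ : E →L[ℝ] E) (q u : E) (t : ℂ) :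
    HasFDerivAt (complexLine K₀ q u)
      (Complex.reCLM.smulRight u + Complex.imCLM.smulRight (K₀ u)) t :=
  ((Complex.reCLM.smulRight u + Complex.imCLM.smulRight (K₀ u)).hasFDerivAt).const_add q

theorem continuous_complexLine (K₀ : E →L[ℝ] E) (q u : E) : Continuous (complexLine K₀ q u) :=
  continuous_iff_continuousAt.2 fun t => (hasFDerivAt_complexLine K₀ q u t).continuousAt

theorem convex_preimage_complexLine (K₀ : E →L[ℝ] E) (q u : E) (r : ℝ) :
    Convex ℝ (complexLine K₀ q u ⁻¹' Metric.ball 0 r) := by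
  have h : complexLine K₀ q u ⁻¹' Metric.ball 0 r
      = (Complex.reCLM.smulRight u + Complex.imCLM.smulRight (K₀ u)).toLinearMap ⁻¹'
        Metric.ball (-q) r := by
    ext t
    simp [complexLine, dist_eq_norm, add_comm]
  rw [h]
  exact (convex_ball _ _).linear_preimage _

/-- Holomorphic functions restrict to holomorphic functions on images of complex lines under a
holomorphic parametrisation. -/
theorem hasDerivAt_comp_complexLine [IsScalarTower ℝ ℂ F] {K : E → E →L[ℝ] E} {K₀ : E →L[ℝ] E}
    {q u : E} {t : ℂ} {X : E → E} {X' : E →L[ℝ] E}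
    (hX : HasFDerivAt X X' (complexLine K₀ q u t))
    (hX' : ∀ v, X' (K₀ v) = K (X (complexLine K₀ q u t)) (X' v))
    {h : E → F} {L : E →L[ℝ] F} (hL : HasFDerivAt h L (X (complexLine K₀ q u t)))
    (hLI : ∀ v, L (K (X (complexLine K₀ q u t)) v) = Complex.I • L v) :
    HasDerivAt (fun s => h (X (complexLine K₀ q u s))) (L (X' u)) t := by
  have hreal := hL.comp t (hX.comp t (hasFDerivAt_complexLine K₀ q u t))
  apply HasFDerivAt.hasDerivAt (f' := (ContinuousLinearMap.id ℂ ℂ).smulRight (L (X' u))) _ |>.congr_deriv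
  · simp
  · refine hasFDerivAt_of_restrictScalars ℝ hreal ?_
    ext s
    have hs : s • L (X' u) = s.re • L (X' u) + s.im • Complex.I • L (X' u) := by
      rw [← algebraMap_smul ℂ s.re, ← algebraMap_smul ℂ s.im, smul_smul, ← add_smul]
      congr 1
      exact (Complex.re_add_im s).symm
    simpa [hX', hLI] using hs

variable {K : E → E →L[ℝ] E} {K₀ : E →L[ℝ] E}

theorem cayley_mul_add {x : E} (hx : IsUnit (K x + K₀)) : cayley K K₀ x * (K x + K₀) = 1 :=
  Ring.inverse_mul_cancel _ hx

theorem add_mul_cayley {x : E} (hx : IsUnit (K x + K₀)) : (K x + K₀) * cayley K K₀ x = 1 :=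
  Ring.mul_inverse_cancel _ hx

theorem cayley_mul {x : E} (hK : K x * K x = -1) (hK₀ : K₀ * K₀ = -1) (hx : IsUnit (K x + K₀)) :
    cayley K K₀ x * K x = K₀ * cayley K K₀ x := by
  have h : K x * (K x + K₀) = (K x + K₀) * K₀ := by rw [mul_add, add_mul, hK, hK₀, add_comm]
  calc cayley K K₀ x * K x = cayley K K₀ x * (K x * (K x + K₀)) * cayley K K₀ x := by
        rw [mul_assoc, mul_assoc, add_mul_cayley hx, mul_one]
    _ = K₀ * cayley K K₀ x := by rw [h, ← mul_assoc, cayley_mul_add hx, one_mul]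

theorem eq_of_cayley {x : E} (hK₀ : K₀ * K₀ = -1) (hx : IsUnit (K x + K₀))
    (h : cayley K K₀ x + (1 / 2 : ℝ) • K₀ = 0) : K x = K₀ := by
  have h1 := add_mul_cayley hx
  rw [eq_neg_of_add_eq_zero_left h] at h1
  have h2 : (K x + K₀) * K₀ = (-2 : ℝ) • (1 : E →L[ℝ] E) := by
    rw [← h1, mul_neg, mul_smul_comm, ← smul_neg, smul_smul, smul_neg, ← neg_smul]
    norm_num
  have h3 : (K x) * K₀ = -1 := by
    rw [add_mul, hK₀] at h2
    have h4 := congrArg (· + (1 : E →L[ℝ] E)) h2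
    simp only [neg_add_cancel_right] at h4
    rw [h4]
    module
  have h5 := congrArg (· * K₀) h3
  simp only [mul_assoc, hK₀] at h5
  simpa using h5

theorem isUnit_add_self (hK₀ : K₀ * K₀ = -1) : IsUnit (K₀ + K₀) := by
  have h1 : (K₀ + K₀) * ((-1 / 2 : ℝ) • K₀) = 1 := by
    rw [mul_smul_comm, add_mul, hK₀]; module
  have h2 : ((-1 / 2 : ℝ) • K₀) * (K₀ + K₀) = 1 := by
    rw [smul_mul_assoc, mul_add, hK₀]; module
  exact ⟨⟨_, _, h1, h2⟩, rfl⟩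

theorem inverse_add_self (hK₀ : K₀ * K₀ = -1) : Ring.inverse (K₀ + K₀) = -((1 / 2 : ℝ) • K₀) := by
  have h1 : (K₀ + K₀) * (-((1 / 2 : ℝ) • K₀)) = 1 := by
    rw [mul_neg, mul_smul_comm, add_mul, hK₀]; module
  calc Ring.inverse (K₀ + K₀)
      = Ring.inverse (K₀ + K₀) * ((K₀ + K₀) * (-((1 / 2 : ℝ) • K₀))) := by rw [h1, mul_one]
    _ = _ := by rw [← mul_assoc, Ring.inverse_mul_cancel _ (isUnit_add_self hK₀), one_mul]

variable [CompleteSpace E]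

theorem contDiffAt_cayley (hK : ContDiff ℝ 1 K) {x : E} (hx : IsUnit (K x + K₀)) :
    ContDiffAt ℝ 1 (cayley K K₀) x := by
  obtain ⟨a, ha⟩ := hx
  have h1 : ContDiffAt ℝ 1 Ring.inverse (K x + K₀) := ha ▸ contDiffAt_ringInverse ℝ a
  exact h1.comp x (hK.contDiffAt.add contDiffAt_const)

theorem hasFDerivAt_cayley (hK : ContDiff ℝ 1 K) {x : E} (hx : IsUnit (K x + K₀)) :
    HasFDerivAt (cayley K K₀) (fderiv ℝ (cayley K K₀) x) x :=
  ((contDiffAt_cayley hK hx).differentiableAt one_ne_zero).hasFDerivAt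

theorem fderiv_cayley_apply (hK : ContDiff ℝ 1 K) {x : E} (hx : IsUnit (K x + K₀)) (v : E) :
    fderiv ℝ (cayley K K₀) x v = -(cayley K K₀ x * fderiv ℝ K x v * cayley K K₀ x) := by
  obtain ⟨a, ha⟩ := hx
  have h1 := hasFDerivAt_ringInverse (𝕜 := ℝ) a
  rw [ha] at h1
  have h2 := ((hK.differentiable one_ne_zero) x).hasFDerivAt.add_const K₀
  have h3 : HasFDerivAt (cayley K K₀) _ x := h1.comp x h2
  rw [h3.fderiv]
  have h4 : cayley K K₀ x = ↑a⁻¹ := by rw [cayley, ← ha, Ring.inverse_unit]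
  rw [h4]
  simp

theorem IsHermitianIntegrable.fderiv_cayley (hK : IsHermitianIntegrable K) (hK₀ : K₀ * K₀ = -1)
    {x : E} (hx : IsUnit (K x + K₀)) (v : E) :
    fderiv ℝ (cayley K K₀) x (K x v) = K₀ * fderiv ℝ (cayley K K₀) x v := by
  rw [fderiv_cayley_apply hK.contDiff hx, fderiv_cayley_apply hK.contDiff hx, hK.fderiv_apply,
    ← mul_assoc, cayley_mul (hK.sq x) hK₀ hx]
  simp only [mul_neg, mul_assoc]

/-- The developing map centred at `p`: a local holomorphic coordinate near `p`. -/
noncomputable def developing (K : E → E →L[ℝ] E) (K₀ : E →L[ℝ] E) (p x : E) : E :=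
  cayley K K₀ x (x - p)

theorem contDiffAt_developing (hK : ContDiff ℝ 1 K) (p : E) {x : E} (hx : IsUnit (K x + K₀)) :
    ContDiffAt ℝ 1 (developing K K₀ p) x :=
  (contDiffAt_cayley hK hx).clm_apply (contDiffAt_id.sub contDiffAt_const)

theorem hasFDerivAt_developing (hK : ContDiff ℝ 1 K) (p : E) {x : E} (hx : IsUnit (K x + K₀)) :
    HasFDerivAt (developing K K₀ p) (fderiv ℝ (developing K K₀ p) x) x :=
  ((contDiffAt_developing hK p hx).differentiableAt one_ne_zero).hasFDerivAt

theorem fderiv_developing_apply (hK : ContDiff ℝ 1 K) (p : E) {x : E} (hx : IsUnit (K x + K₀))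
    (v : E) : fderiv ℝ (developing K K₀ p) x v
      = cayley K K₀ x v + fderiv ℝ (cayley K K₀) x v (x - p) := by
  have h : HasFDerivAt (developing K K₀ p) _ x :=
    (hasFDerivAt_cayley hK hx).clm_apply ((hasFDerivAt_id x).sub_const p)
  rw [h.fderiv]
  simp

theorem IsHermitianIntegrable.fderiv_developing (hK : IsHermitianIntegrable K)
    (hK₀ : K₀ * K₀ = -1) (p : E) {x : E} (hx : IsUnit (K x + K₀)) (v : E) :
    fderiv ℝ (developing K K₀ p) x (K x v) = K₀ (fderiv ℝ (developing K K₀ p) x v) := by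
  have h := congrArg (fun A : E →L[ℝ] E => A v) (cayley_mul (hK.sq x) hK₀ hx)
  simp only [mul_apply_eq_comp] at h
  rw [fderiv_developing_apply hK.contDiff p hx, fderiv_developing_apply hK.contDiff p hx,
    hK.fderiv_cayley hK₀ hx, h, map_add]
  rfl

theorem eventually_isUnit_add (hK : ContDiff ℝ 1 K) {x : E} (hx : IsUnit (K x + K₀)) :
    ∀ᶠ y in nhds x, IsUnit (K y + K₀) :=
  (hK.continuous.add continuous_const).continuousAt.eventually (Units.isOpen.mem_nhds hx)

/-- Local holomorphic parametrisations `X` of `(E, K)` by `(E, K₀)`. -/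
theorem IsHermitianIntegrable.exists_parametrisation (hK : IsHermitianIntegrable K)
    (hK₀ : K₀ * K₀ = -1) {p : E} (hp : IsUnit (K p + K₀)) :
    ∃ r > 0, ∃ X : E → E, X 0 = p ∧
      (∀ y ∈ Metric.ball (0 : E) r, IsUnit (K (X y) + K₀) ∧
        ∃ X' : E →L[ℝ] E, HasFDerivAt X X' y ∧ ∀ u, X' (K₀ u) = K (X y) (X' u)) ∧
      (∀ X' : E →L[ℝ] E, HasFDerivAt X X' 0 → ∀ v, X' (cayley K K₀ p v) = v) ∧
      ∀ᶠ x in nhds p, ∃ y ∈ Metric.ball (0 : E) r, X y = x := by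
  set Y := developing K K₀ p
  have hY0 : Y p = 0 := by simp [Y, developing]
  let e : E ≃L[ℝ] E := ContinuousLinearEquiv.equivOfInverse (cayley K K₀ p) (K p + K₀)
    (fun v => congrArg (fun A : E →L[ℝ] E => A v) (add_mul_cayley hp))
    (fun v => congrArg (fun A : E →L[ℝ] E => A v) (cayley_mul_add hp))
  have hYe : HasFDerivAt Y (e : E →L[ℝ] E) p := by
    convert hasFDerivAt_developing hK.contDiff p hp using 1
    ext v
    rw [fderiv_developing_apply hK.contDiff p hp, sub_self, map_zero, add_zero]
    rfl
  have hYc := contDiffAt_developing hK.contDiff p hp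
  let φ := hYc.toOpenPartialHomeomorph Y hYe one_ne_zero
  have hφ : ∀ x, φ x = Y x := fun x => rfl
  have hps : p ∈ φ.source := hYc.mem_toOpenPartialHomeomorph_source hYe one_ne_zero
  have h0t : (0 : E) ∈ φ.target := hY0 ▸ φ.map_source hps
  have hX0 : φ.symm 0 = p := by rw [← hY0]; exact φ.left_inv hps
  have hXc : ContDiffAt ℝ 1 φ.symm 0 := by
    apply φ.contDiffAt_symm h0t (f₀' := e) <;> rw [hX0]
    · exact hYe
    · exact hYc
  have hXcont : ContinuousAt φ.symm 0 := hXc.continuousAt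
  have hleft : ∀ y ∈ φ.target, IsUnit (K (φ.symm y) + K₀) → ∀ X' : E →L[ℝ] E,
      HasFDerivAt φ.symm X' y → ∀ v, X' (fderiv ℝ Y (φ.symm y) v) = v := by
    intro y hy hu X' hX' v
    have h1 := hasFDerivAt_developing hK.contDiff p hu
    have h2 : HasFDerivAt φ.symm X' (Y (φ.symm y)) := by rw [← hφ, φ.right_inv hy]; exact hX'
    have h3 := h2.comp _ h1
    have h4 : φ.symm ∘ Y =ᶠ[nhds (φ.symm y)] id := by
      filter_upwards [φ.open_source.mem_nhds (φ.map_target hy)] with x hx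
      exact φ.left_inv hx
    have h5 := (h3.congr_of_eventuallyEq h4.symm).unique (hasFDerivAt_id _)
    exact congrArg (fun A : E →L[ℝ] E => A v) h5
  have hright : ∀ y ∈ φ.target, IsUnit (K (φ.symm y) + K₀) → ∀ X' : E →L[ℝ] E,
      HasFDerivAt φ.symm X' y → ∀ v, fderiv ℝ Y (φ.symm y) (X' v) = v := by
    intro y hy hu X' hX' v
    have h3 := (hasFDerivAt_developing hK.contDiff p hu).comp y hX'
    have h4 : Y ∘ φ.symm =ᶠ[nhds y] id := by
      filter_upwards [φ.open_target.mem_nhds hy] with x hx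
      exact φ.right_inv hx
    have h5 := (h3.congr_of_eventuallyEq h4.symm).unique (hasFDerivAt_id _)
    exact congrArg (fun A : E →L[ℝ] E => A v) h5
  have hu0 : ∀ᶠ y in nhds (0 : E), IsUnit (K (φ.symm y) + K₀) :=
    hXcont.eventually (by rw [hX0]; exact eventually_isUnit_add hK.contDiff hp)
  have hev : ∀ᶠ y in nhds (0 : E), y ∈ φ.target ∧ IsUnit (K (φ.symm y) + K₀) ∧
      DifferentiableAt ℝ φ.symm y := by
    filter_upwards [φ.open_target.mem_nhds h0t, hu0, hXc.eventually (by simp)] with y h1 h2 h3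
    exact ⟨h1, h2, h3.differentiableAt one_ne_zero⟩
  obtain ⟨r, hr, hball⟩ := Metric.eventually_nhds_iff_ball.1 hev
  refine ⟨r, hr, φ.symm, hX0, fun y hy => ?_, fun X' hX' v => ?_, ?_⟩
  · obtain ⟨ht, hu, hd⟩ := hball y hy
    refine ⟨hu, _, hd.hasFDerivAt, fun u => ?_⟩
    conv_lhs => rw [← hright y ht hu _ hd.hasFDerivAt u, ← hK.fderiv_developing hK₀ p hu]
    rw [hleft y ht hu _ hd.hasFDerivAt]
  · have h := hleft 0 h0t (by rw [hX0]; exact hp) X' hX' v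
    rw [hX0, hYe.fderiv] at h
    exact h
  · have hYt : Tendsto Y (nhds p) (nhds 0) := hY0 ▸ hYc.continuousAt.tendsto
    have h1 := hYt.eventually (Metric.ball_mem_nhds 0 hr)
    filter_upwards [h1, φ.open_source.mem_nhds hps] with x hx hxs
    exact ⟨Y x, hx, φ.left_inv hxs⟩

end IntegrableFields

section Coordinates

variable {ι : Type*} [Fintype ι]

/-- The identification of pairs (vector, operator), complexified through `K₀`, with the coordinates
of a complex Euclidean space. -/
noncomputable def complexCoordinates [DecidableEq ι] (K₀ : (ι → ℝ) →L[ℝ] (ι → ℝ)) :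
    ((ι → ℝ) × ((ι → ℝ) →L[ℝ] (ι → ℝ))) →L[ℝ] EuclideanSpace ℂ (Option ι × ι) :=
  LinearMap.toContinuousLinearMap
    { toFun := fun z => WithLp.toLp 2 fun k =>
        ((k.1.elim z.1 (fun j => z.2 (Pi.single j 1)) k.2 : ℝ) : ℂ)
          - Complex.I * ((K₀ (k.1.elim z.1 (fun j => z.2 (Pi.single j 1))) k.2 : ℝ) : ℂ)
      map_add' := by
        rintro ⟨a, A⟩ ⟨b, B⟩
        ext ⟨_ | j, i⟩ <;> simp <;> ring
      map_smul' := by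
        rintro r ⟨a, A⟩
        ext ⟨_ | j, i⟩ <;> simp <;> ring }

variable [DecidableEq ι] {K₀ : (ι → ℝ) →L[ℝ] (ι → ℝ)}

theorem complexCoordinates_none (a : ι → ℝ) (A : (ι → ℝ) →L[ℝ] (ι → ℝ)) (i : ι) :
    complexCoordinates K₀ (a, A) (none, i) = (a i : ℂ) - Complex.I * (K₀ a i : ℝ) := rfl

theorem complexCoordinates_some (a : ι → ℝ) (A : (ι → ℝ) →L[ℝ] (ι → ℝ)) (j i : ι) :
    complexCoordinates K₀ (a, A) (some j, i)
      = (A (Pi.single j 1) i : ℂ) - Complex.I * (K₀ (A (Pi.single j 1)) i : ℝ) := rfl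

theorem complexCoordinates_mul (hK₀ : K₀ * K₀ = -1) (a : ι → ℝ)
    (A : (ι → ℝ) →L[ℝ] (ι → ℝ)) :
    complexCoordinates K₀ (K₀ a, K₀ * A) = Complex.I • complexCoordinates K₀ (a, A) := by
  have h : ∀ u, K₀ (K₀ u) = -u := fun u => congrArg (fun B : (ι → ℝ) →L[ℝ] (ι → ℝ) => B u) hK₀
  ext ⟨_ | j, i⟩
  · rw [PiLp.smul_apply, complexCoordinates_none, complexCoordinates_none, h, smul_eq_mul]
    push_cast [Pi.neg_apply]
    linear_combination (K₀ a i : ℂ) * Complex.I_mul_I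
  · rw [PiLp.smul_apply, complexCoordinates_some, complexCoordinates_some, mul_apply_eq_comp, h,
      smul_eq_mul]
    push_cast [Pi.neg_apply]
    linear_combination (K₀ (A (Pi.single j 1)) i : ℂ) * Complex.I_mul_I

theorem norm_fst_le_norm_complexCoordinates (a : ι → ℝ) (A : (ι → ℝ) →L[ℝ] (ι → ℝ)) :
    ‖a‖ ≤ ‖complexCoordinates K₀ (a, A)‖ := by
  refine (pi_norm_le_iff_of_nonneg (norm_nonneg _)).2 fun i => ?_
  refine le_trans ?_ (PiLp.norm_apply_le (complexCoordinates K₀ (a, A)) (none, i))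
  rw [complexCoordinates_none]
  refine le_trans (le_of_eq ?_) (Complex.abs_re_le_norm _)
  simp

theorem eq_zero_of_complexCoordinates_some {a : ι → ℝ} {A : (ι → ℝ) →L[ℝ] (ι → ℝ)}
    (h : ∀ j i, complexCoordinates K₀ (a, A) (some j, i) = 0) : A = 0 := by
  have h1 : ∀ j i, A (Pi.single j 1) i = 0 := by
    intro j i
    have := congrArg Complex.re (h j i)
    rw [complexCoordinates_some] at this
    simpa using this
  apply ContinuousLinearMap.coe_injective
  apply LinearMap.pi_ext'
  intro j
  ext i
  simpa using h1 j i

theorem complexCoordinates_eq_zero {a : ι → ℝ} {A : (ι → ℝ) →L[ℝ] (ι → ℝ)}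
    (h : complexCoordinates K₀ (a, A) = 0) : a = 0 ∧ A = 0 := by
  refine ⟨?_, eq_zero_of_complexCoordinates_some fun j i => by rw [h]; rfl⟩
  have h1 := norm_fst_le_norm_complexCoordinates (K₀ := K₀) a A
  rw [h, norm_zero] at h1
  exact norm_le_zero_iff.1 h1

variable {K : (ι → ℝ) → (ι → ℝ) →L[ℝ] (ι → ℝ)}

/-- The global holomorphic map given by the developing map and the Cayley coordinate, the latter
normalised to vanish where `K = K₀`. -/
noncomputable def twistorMap (K : (ι → ℝ) → (ι → ℝ) →L[ℝ] (ι → ℝ))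
    (K₀ : (ι → ℝ) →L[ℝ] (ι → ℝ)) (x : ι → ℝ) : EuclideanSpace ℂ (Option ι × ι) :=
  complexCoordinates K₀ (developing K K₀ 0 x, cayley K K₀ x + (1 / 2 : ℝ) • K₀)

/-- The derivative of `twistorMap`. -/
noncomputable def twistorDeriv (K : (ι → ℝ) → (ι → ℝ) →L[ℝ] (ι → ℝ))
    (K₀ : (ι → ℝ) →L[ℝ] (ι → ℝ)) (x : ι → ℝ) :
    (ι → ℝ) →L[ℝ] EuclideanSpace ℂ (Option ι × ι) :=
  (complexCoordinates K₀).comp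
    ((fderiv ℝ (developing K K₀ 0) x).prod (fderiv ℝ (cayley K K₀) x))

theorem hasFDerivAt_twistorMap (hK : ContDiff ℝ 1 K) {x : ι → ℝ} (hx : IsUnit (K x + K₀)) :
    HasFDerivAt (twistorMap K K₀) (twistorDeriv K K₀ x) x :=
  (complexCoordinates K₀).hasFDerivAt.comp x
    ((hasFDerivAt_developing hK 0 hx).prodMk ((hasFDerivAt_cayley hK hx).add_const _))

theorem IsHermitianIntegrable.twistorDeriv_apply (hK : IsHermitianIntegrable K)
    (hK₀ : K₀ * K₀ = -1) {x : ι → ℝ} (hx : IsUnit (K x + K₀)) (v : ι → ℝ) :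
    twistorDeriv K K₀ x (K x v) = Complex.I • twistorDeriv K K₀ x v := by
  have h := complexCoordinates_mul hK₀ (fderiv ℝ (developing K K₀ 0) x v)
    (fderiv ℝ (cayley K K₀) x v)
  rw [← hK.fderiv_developing hK₀ 0 hx, ← hK.fderiv_cayley hK₀ hx] at h
  exact h

theorem twistorDeriv_injective (hK : ContDiff ℝ 1 K) {x : ι → ℝ} (hx : IsUnit (K x + K₀))
    {v : ι → ℝ} (h : twistorDeriv K K₀ x v = 0) : v = 0 := by
  obtain ⟨h1, h2⟩ := complexCoordinates_eq_zero
    (a := fderiv ℝ (developing K K₀ 0) x v) (A := fderiv ℝ (cayley K K₀) x v) h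
  rw [fderiv_developing_apply hK 0 hx, h2] at h1
  have h3 : cayley K K₀ x v = 0 := by simpa using h1
  have h4 := congrArg (fun A : (ι → ℝ) →L[ℝ] (ι → ℝ) => A v) (add_mul_cayley hx)
  simp only [mul_apply_eq_comp, h3, map_zero] at h4
  exact h4.symm

theorem eq_of_twistorMap_some (hK₀ : K₀ * K₀ = -1) {x : ι → ℝ} (hx : IsUnit (K x + K₀))
    (h : ∀ j i, twistorMap K K₀ x (some j, i) = 0) : K x = K₀ :=
  eq_of_cayley hK₀ hx (eq_zero_of_complexCoordinates_some h)

theorem twistorMap_some_of_eq (hK₀ : K₀ * K₀ = -1) {x : ι → ℝ} (hx : K x = K₀) (j i : ι) :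
    twistorMap K K₀ x (some j, i) = 0 := by
  rw [twistorMap, complexCoordinates_some, cayley, hx, inverse_add_self hK₀]
  simp

/-- The twistor map is analytic along parametrised complex lines. -/
theorem IsHermitianIntegrable.hasDerivAt_twistorMap_comp (hK : IsHermitianIntegrable K)
    (hK₀ : K₀ * K₀ = -1) {q u : ι → ℝ} {t : ℂ} {X : (ι → ℝ) → ι → ℝ}
    {X' : (ι → ℝ) →L[ℝ] (ι → ℝ)} (hx : IsUnit (K (X (complexLine K₀ q u t)) + K₀))
    (hX : HasFDerivAt X X' (complexLine K₀ q u t))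
    (hX' : ∀ v, X' (K₀ v) = K (X (complexLine K₀ q u t)) (X' v)) :
    HasDerivAt (fun s => twistorMap K K₀ (X (complexLine K₀ q u s)))
      (twistorDeriv K K₀ (X (complexLine K₀ q u t)) (X' u)) t :=
  hasDerivAt_comp_complexLine hX hX' (hasFDerivAt_twistorMap hK.contDiff hx)
    (hK.twistorDeriv_apply hK₀ hx)

/-- Unique continuation from a neighbourhood of infinity. -/
theorem IsHermitianIntegrable.eq_of_eventually_eq [Nonempty ι] (hK : IsHermitianIntegrable K)
    (hK₀ : K₀ * K₀ = -1) (h : ∀ᶠ x in cocompact (ι → ℝ), K x = K₀) (x : ι → ℝ) : K x = K₀ := by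
  set W := interior {x | K x = K₀}
  suffices hW : W = Set.univ by
    have : x ∈ W := hW ▸ Set.mem_univ x
    exact (interior_subset : W ⊆ {x | K x = K₀}) this
  have hcl : IsClosed {x | K x = K₀} := isClosed_eq hK.contDiff.continuous continuous_const
  refine IsClopen.eq_univ ⟨?_, isOpen_interior⟩ ?_
  · refine isClosed_of_closure_subset fun p hp => ?_
    have hKp : K p = K₀ := closure_minimal interior_subset hcl hp
    obtain ⟨r, hr, X, -, hball, -, hcover⟩ := hK.exists_parametrisation hK₀ (p := p)
      (by rw [hKp]; exact isUnit_add_self hK₀)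
    obtain ⟨_, hqW, q, hq, rfl⟩ := ((mem_closure_iff_frequently.1 hp).and_eventually hcover).exists
    rw [mem_interior_iff_mem_nhds]
    filter_upwards [hcover]
    rintro _ ⟨y, hy, rfl⟩
    set Ω := complexLine K₀ q (y - q) ⁻¹' Metric.ball 0 r
    have hΩ : IsOpen Ω := Metric.isOpen_ball.preimage (continuous_complexLine _ _ _)
    have h0 : complexLine K₀ q (y - q) 0 = q := by simp [complexLine]
    have h1 : complexLine K₀ q (y - q) 1 = y := by simp [complexLine]
    have han : AnalyticOnNhd ℂ (fun t => twistorMap K K₀ (X (complexLine K₀ q (y - q) t))) Ω := by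
      refine DifferentiableOn.analyticOnNhd (fun t ht => ?_) hΩ
      obtain ⟨hu, X', hX, hX'⟩ := hball _ ht
      exact (hK.hasDerivAt_twistorMap_comp hK₀ hu hX hX').differentiableAt.differentiableWithinAt
    refine eq_of_twistorMap_some hK₀ (hball y hy).1 fun j i => ?_
    have hanc : AnalyticOnNhd ℂ
        (fun t => twistorMap K K₀ (X (complexLine K₀ q (y - q) t)) (some j, i)) Ω := fun t ht =>
      (EuclideanSpace.proj (𝕜 := ℂ) ((some j, i) : Option ι × ι)).analyticAt _ |>.comp (han t ht)
    have hev : (fun t => twistorMap K K₀ (X (complexLine K₀ q (y - q) t)) (some j, i))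
        =ᶠ[nhds 0] 0 := by
      obtain ⟨-, X', hX, -⟩ := hball q hq
      have hc : ContinuousAt (fun t => X (complexLine K₀ q (y - q) t)) 0 :=
        ContinuousAt.comp (g := X) (by rw [h0]; exact hX.continuousAt)
          (continuous_complexLine _ _ _).continuousAt
      have hWn : W ∈ nhds (X (complexLine K₀ q (y - q) 0)) := by
        rw [h0]; exact isOpen_interior.mem_nhds hqW
      filter_upwards [hc.eventually hWn] with t ht
      have ht' : X (complexLine K₀ q (y - q) t) ∈ W := ht
      exact twistorMap_some_of_eq hK₀ ((interior_subset : W ⊆ {x | K x = K₀}) ht') j i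
    have := hanc.eqOn_zero_of_preconnected_of_eventuallyEq_zero
      (convex_preimage_complexLine _ _ _ _).isPreconnected (by simpa [Ω, h0] using hq) hev
      (show (1 : ℂ) ∈ Ω by simpa [Ω, h1] using hy)
    simpa [h1] using this
  · obtain ⟨t, ht, hts⟩ := mem_cocompact.1 h
    obtain ⟨y, hy⟩ : (tᶜ).Nonempty := (cocompact (ι → ℝ)).nonempty_of_mem ht.compl_mem_cocompact
    exact ⟨y, interior_mono hts (by rwa [ht.isClosed.isOpen_compl.interior_eq])⟩

theorem IsHermitianIntegrable.not_isLocalMax (hK : IsHermitianIntegrable K)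
    (hK₀ : K₀ * K₀ = -1) (hι : 2 < Fintype.card ι) {x : ι → ℝ} (hx : IsUnit (K x + K₀))
    (k : Option ι × ι) (hk : twistorMap K K₀ x k ≠ 0) {c : ℝ} (hc : 0 < c)
    (hcx : c < ‖twistorMap K K₀ x‖ ^ 2) :
    ¬ IsLocalMax (fun y => ‖twistorMap K K₀ y k‖ ^ 2 * (1 - c / ‖twistorMap K K₀ y‖ ^ 2)) x := by
  intro hmax
  obtain ⟨v, hv, hv0⟩ : ∃ v, inner ℂ (twistorMap K K₀ x) (twistorDeriv K K₀ x v) = 0 ∧ v ≠ 0 := by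
    let ℓ : (ι → ℝ) →ₗ[ℝ] ℂ :=
      ((innerSL ℂ (twistorMap K K₀ x)).toLinearMap.restrictScalars ℝ).comp
        (twistorDeriv K K₀ x).toLinearMap
    have hker : LinearMap.ker ℓ ≠ ⊥ := LinearMap.ker_ne_bot_of_finrank_lt (by
      rw [Complex.finrank_real_complex, Module.finrank_fintype_fun_eq_card]; exact hι)
    obtain ⟨v, hv, hv0⟩ := (Submodule.ne_bot_iff _).1 hker
    exact ⟨v, hv, hv0⟩
  obtain ⟨r, hr, X, hX0, hball, hinv, -⟩ := hK.exists_parametrisation hK₀ hx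
  set u := cayley K K₀ x v
  have h0 : complexLine K₀ 0 u 0 = 0 := by simp [complexLine]
  have hnhds : complexLine K₀ 0 u ⁻¹' Metric.ball 0 r ∈ nhds 0 :=
    (continuous_complexLine K₀ 0 u).continuousAt.preimage_mem_nhds
      (by rw [h0]; exact Metric.ball_mem_nhds 0 hr)
  have hg : AnalyticAt ℂ (fun t => twistorMap K K₀ (X (complexLine K₀ 0 u t))) 0 := by
    refine DifferentiableOn.analyticAt (fun t ht => ?_) hnhds
    obtain ⟨hu, X', hX, hX'⟩ := hball _ ht
    exact (hK.hasDerivAt_twistorMap_comp hK₀ hu hX hX').differentiableAt.differentiableWithinAt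
  obtain ⟨hu, X', hX, hX'⟩ := hball 0 (Metric.mem_ball_self hr)
  have hderiv : deriv (fun t => twistorMap K K₀ (X (complexLine K₀ 0 u t))) 0
      = twistorDeriv K K₀ x v := by
    have := hK.hasDerivAt_twistorMap_comp hK₀ (q := 0) (u := u) (t := 0) (X := X) (X' := X')
      (by rwa [h0]) (by rwa [h0]) (by rwa [h0])
    rw [this.deriv, h0, hX0, hinv X' hX]
  have hXc : Tendsto (fun t => X (complexLine K₀ 0 u t)) (nhds 0) (nhds x) := by
    have : ContinuousAt (fun t => X (complexLine K₀ 0 u t)) 0 :=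
      ContinuousAt.comp (g := X) (by rw [h0]; exact hX.continuousAt)
        (continuous_complexLine _ _ _).continuousAt
    have := this.tendsto
    rwa [h0, hX0] at this
  refine not_isLocalMax_norm_sq_mul (c := c)
    (f := fun t => twistorMap K K₀ (X (complexLine K₀ 0 u t)) k) hg
    ((EuclideanSpace.proj (𝕜 := ℂ) k).analyticAt _ |>.comp hg) (by rwa [h0, hX0])
    (by rw [hderiv, h0, hX0]; exact hv)
    (by rw [hderiv]; exact fun h => hv0 (twistorDeriv_injective hK.contDiff hx h)) hc
    (by rwa [h0, hX0]) ?_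
  filter_upwards [hXc.eventually hmax] with t ht
  rw [h0, hX0]
  exact ht

/-- A Hartogs-type theorem: in complex dimension at least two, an integrable field which is
asymptotic to a constant structure agrees with it near infinity. -/
theorem IsHermitianIntegrable.eventually_eq (hK : IsHermitianIntegrable K)
    (hK₀ : K₀ * K₀ = -1) (hι : 2 < Fintype.card ι)
    (hlim : Tendsto K (cocompact (ι → ℝ)) (nhds K₀)) :
    ∀ᶠ x in cocompact (ι → ℝ), K x = K₀ := by
  have hlim2 : Tendsto (fun x => K x + K₀) (cocompact (ι → ℝ)) (nhds (K₀ + K₀)) :=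
    hlim.add_const K₀
  set C := ‖K₀ + K₀‖ + 1
  have hC : 0 < C := by positivity
  have hev : ∀ᶠ x in cocompact (ι → ℝ), IsUnit (K x + K₀) ∧ ‖K x + K₀‖ ≤ C := by
    refine (hlim2.eventually (Units.isOpen.mem_nhds (isUnit_add_self hK₀))).and ?_
    filter_upwards [hlim2.norm.eventually (gt_mem_nhds (lt_add_one ‖K₀ + K₀‖))] with x hx
    exact hx.le
  rw [← Metric.cobounded_eq_cocompact, hasBasis_cobounded_norm.eventually_iff] at hev
  obtain ⟨R₀, -, hR₀⟩ := hev
  set R := max R₀ 1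
  have hR1 : 1 ≤ R := le_max_right _ _
  have hR : ∀ x, R ≤ ‖x‖ → IsUnit (K x + K₀) ∧ ‖K x + K₀‖ ≤ C := fun x hx =>
    hR₀ ((le_max_left _ _).trans hx)
  set G := twistorMap K K₀
  have hGc : ∀ x, R ≤ ‖x‖ → ContinuousAt G x := fun x hx =>
    (hasFDerivAt_twistorMap hK.contDiff (hR x hx).1).continuousAt
  have hGx : ∀ x, R ≤ ‖x‖ → ‖x‖ ≤ C * ‖G x‖ := by
    intro x hx
    have h1 := congrArg (fun A : (ι → ℝ) →L[ℝ] (ι → ℝ) => A x) (add_mul_cayley (hR x hx).1)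
    have h2 : ‖(K x + K₀) (cayley K K₀ x x)‖ = ‖x‖ := congrArg norm h1
    rw [← h2]
    refine ((K x + K₀).le_opNorm _).trans ?_
    have h3 : ‖cayley K K₀ x x‖ ≤ ‖G x‖ := by
      have h4 : cayley K K₀ x x = developing K K₀ 0 x := by simp [developing]
      rw [h4]
      exact norm_fst_le_norm_complexCoordinates _ _
    exact mul_le_mul (hR x hx).2 h3 (norm_nonneg _) hC.le
  have hGpos : ∀ x, R ≤ ‖x‖ → 0 < ‖G x‖ := by
    intro x hx
    have := hGx x hx
    by_contra hcon
    have h0 : ‖G x‖ = 0 := le_antisymm (not_lt.1 hcon) (norm_nonneg _)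
    rw [h0, mul_zero] at this
    linarith
  obtain ⟨M, hM⟩ := (isCompact_sphere (0 : ι → ℝ) R).exists_bound_of_continuousOn
    (f := G) fun x hx => (hGc x (by simpa using (mem_sphere_zero_iff_norm.1 hx).ge)).continuousWithinAt
  set c := M ^ 2 + 2
  have hc : 0 < c := by positivity
  have hlimk : ∀ j i, Tendsto (fun x => G x (some j, i)) (cocompact (ι → ℝ)) (nhds 0) := by
    intro j i
    have h1 : Tendsto (fun x => cayley K K₀ x + (1 / 2 : ℝ) • K₀) (cocompact (ι → ℝ)) (nhds 0) := by
      obtain ⟨a, ha⟩ := isUnit_add_self hK₀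
      have h2 : ContinuousAt Ring.inverse (K₀ + K₀) := ha ▸ NormedRing.inverse_continuousAt a
      have h3 := (h2.tendsto.comp hlim2).add_const ((1 / 2 : ℝ) • K₀)
      rw [inverse_add_self hK₀, neg_add_cancel] at h3
      exact h3
    have h2 : Continuous fun A : (ι → ℝ) →L[ℝ] (ι → ℝ) =>
        complexCoordinates K₀ (0, A) (some j, i) :=
      (EuclideanSpace.proj (𝕜 := ℂ) ((some j, i) : Option ι × ι)).continuous.comp
        ((complexCoordinates K₀).continuous.comp (by fun_prop))
    have h3 := (h2.tendsto 0).comp h1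
    have h4 : complexCoordinates K₀ (0, 0) ((some j, i) : Option ι × ι) = 0 := by
      simp [complexCoordinates_some]
    rw [h4] at h3
    exact h3
  have hzero : ∀ x, R ≤ ‖x‖ → c < ‖G x‖ ^ 2 → ∀ j i, G x (some j, i) = 0 := by
    intro p hp hcp j i
    by_contra hne
    set Φ : (ι → ℝ) → ℝ := fun y => ‖G y (some j, i)‖ ^ 2 * (1 - c / ‖G y‖ ^ 2) with hΦ
    have hΦp : 0 < Φ p := by
      have h1 : 0 < ‖G p (some j, i)‖ := norm_pos_iff.2 hne
      have h2 : c / ‖G p‖ ^ 2 < 1 := (div_lt_one (hc.trans hcp)).2 hcp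
      have h3 : 0 < 1 - c / ‖G p‖ ^ 2 := by linarith
      positivity
    have hcl : IsClosed {x : ι → ℝ | R ≤ ‖x‖} := isClosed_le continuous_const continuous_norm
    have hΦc : ContinuousOn Φ {x | R ≤ ‖x‖} := by
      intro x hx
      have h1 := hGc x hx
      have h2 : ContinuousAt (fun y => G y (some j, i)) x :=
        (EuclideanSpace.proj (𝕜 := ℂ) ((some j, i) : Option ι × ι)).continuous.continuousAt.comp h1
      refine ContinuousAt.continuousWithinAt ?_
      exact (h2.norm.pow 2).mul (continuousAt_const.sub
        (continuousAt_const.div (h1.norm.pow 2) (pow_ne_zero 2 (hGpos x hx).ne')))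
    have hΦle : ∀ y, Φ y ≤ ‖G y (some j, i)‖ ^ 2 := by
      intro y
      have h1 : 0 ≤ c / ‖G y‖ ^ 2 := by positivity
      simp only [hΦ]
      nlinarith [sq_nonneg ‖G y (some j, i)‖]
    have hsmall : ∀ᶠ y in cocompact (ι → ℝ) ⊓ Filter.principal {x | R ≤ ‖x‖}, Φ y ≤ Φ p := by
      refine Filter.Eventually.filter_mono inf_le_left ?_
      have h1 := (hlimk j i).norm.pow 2
      rw [norm_zero, zero_pow two_ne_zero] at h1
      filter_upwards [h1.eventually (gt_mem_nhds hΦp)] with y hy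
      exact (hΦle y).trans hy.le
    obtain ⟨x, hx, hmax⟩ := hΦc.exists_isMaxOn' hcl hp hsmall
    have hΦx : 0 < Φ x := hΦp.trans_le (hmax hp)
    have hGk : G x (some j, i) ≠ 0 := by
      intro h
      simp [hΦ, h] at hΦx
    have hcx : c < ‖G x‖ ^ 2 := by
      have h1 : 0 < 1 - c / ‖G x‖ ^ 2 := pos_of_mul_pos_right hΦx (sq_nonneg _)
      rw [sub_pos, div_lt_one (pow_pos (hGpos x hx) 2)] at h1
      exact h1
    have hxR : R < ‖x‖ := by
      refine lt_of_le_of_ne hx fun h => ?_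
      have h1 := hM x (mem_sphere_zero_iff_norm.2 h.symm)
      have h2 : ‖G x‖ ^ 2 ≤ M ^ 2 := pow_le_pow_left₀ (norm_nonneg _) h1 2
      linarith
    have hloc : IsLocalMax Φ x := hmax.isLocalMax
      (mem_of_superset ((isOpen_lt continuous_const continuous_norm).mem_nhds hxR)
        fun y (hy : R < ‖y‖) => hy.le)
    exact hK.not_isLocalMax hK₀ hι (hR x hx).1 (some j, i) hGk hc hcx hloc
  rw [← Metric.cobounded_eq_cocompact, hasBasis_cobounded_norm.eventually_iff]
  refine ⟨max R (C * c), trivial, fun {x} hx => ?_⟩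
  have hxR : R ≤ ‖x‖ := (le_max_left _ _).trans hx
  refine eq_of_twistorMap_some hK₀ (hR x hxR).1 (hzero x hxR ?_)
  have h1 : C * c ≤ C * ‖G x‖ := ((le_max_right _ _).trans hx).trans (hGx x hxR)
  have h2 : c ≤ ‖G x‖ := le_of_mul_le_mul_left h1 hC
  have h3 : 2 ≤ c := by linarith [sq_nonneg M]
  nlinarith

end Coordinates

section MatrixFields

variable {ι : Type*} [Fintype ι]

/-- The vanishing of the Nijenhuis tensor of an orthogonal field is equivalent to
`∂_{Jv} J = J ∂_v J`. -/
theorem fderiv_mulVec_of_nijenhuis_eq_zero [DecidableEq ι] {J : (ι → ℝ) → Matrix ι ι ℝ}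
    (hC1 : ContDiff ℝ 1 J) (hskew : ∀ x, (J x)ᵀ = -J x) (hsq : ∀ x, J x * J x = -1)
    (hinteg : ∀ x v w, nijenhuis J x v w = 0) (x v : ι → ℝ) :
    fderiv ℝ J x ((J x).mulVec v) = J x * fderiv ℝ J x v := by
  have hd : HasFDerivAt J (fderiv ℝ J x) x := (hC1.differentiable one_ne_zero x).hasFDerivAt
  have hline : ∀ u, HasDerivAt (fun t : ℝ => J (x + t • u)) (fderiv ℝ J x u) 0 := by
    intro u
    have h1 : HasDerivAt (fun t : ℝ => x + t • u) u 0 := by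
      simpa using ((hasDerivAt_id (0 : ℝ)).smul_const u).const_add x
    have h2 : HasFDerivAt J (fderiv ℝ J x) (x + (0 : ℝ) • u) := by simpa using hd
    exact h2.comp_hasDerivAt (0 : ℝ) h1
  have hentry : ∀ u i j, HasDerivAt (fun t : ℝ => J (x + t • u) i j) (fderiv ℝ J x u i j) 0 :=
    fun u i j => hasDerivAt_pi.1 (hasDerivAt_pi.1 (hline u) i) j
  have hAskew : ∀ u, (fderiv ℝ J x u)ᵀ = -fderiv ℝ J x u := by
    intro u
    ext i j
    have h1 := hentry u j i
    have h2 := (hentry u i j).neg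
    have h3 : (fun t : ℝ => J (x + t • u) j i) = fun t => -J (x + t • u) i j := by
      funext t
      exact congrFun (congrFun (hskew (x + t • u)) i) j
    rw [h3] at h1
    exact h1.unique h2
  have hanti : ∀ u, fderiv ℝ J x u * J x = -(J x * fderiv ℝ J x u) := by
    intro u
    rw [eq_neg_iff_add_eq_zero]
    ext i j
    have h1 : HasDerivAt (fun t : ℝ => ∑ k, J (x + t • u) i k * J (x + t • u) k j)
        (∑ k, (fderiv ℝ J x u i k * J (x + (0 : ℝ) • u) k j
          + J (x + (0 : ℝ) • u) i k * fderiv ℝ J x u k j)) 0 :=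
      HasDerivAt.fun_sum fun k _ => (hentry u i k).mul (hentry u k j)
    have h2 : (fun t : ℝ => ∑ k, J (x + t • u) i k * J (x + t • u) k j)
        = fun _ => (-1 : Matrix ι ι ℝ) i j := by
      funext t
      exact congrFun (congrFun (hsq (x + t • u)) i) j
    rw [h2] at h1
    have h3 := h1.unique (hasDerivAt_const (0 : ℝ) _)
    simpa [Matrix.mul_apply, Finset.sum_add_distrib] using h3
  set B : (ι → ℝ) → Matrix ι ι ℝ := fun u => fderiv ℝ J x ((J x).mulVec u) - J x * fderiv ℝ J x u
    with hB
  have hBsymm : ∀ u w, (B u).mulVec w = (B w).mulVec u := by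
    intro u w
    have h := hinteg x u w
    rw [nijenhuis] at h
    simp only [hB, Matrix.sub_mulVec, ← Matrix.mulVec_mulVec]
    rw [← sub_eq_zero, ← h]
    abel
  have hBskew : ∀ u, (B u)ᵀ = -B u := by
    intro u
    simp only [hB, Matrix.transpose_sub, Matrix.transpose_mul, hAskew, hskew, Matrix.neg_mul,
      Matrix.mul_neg, neg_neg, hanti]
    abel
  have hform : ∀ u w z, z ⬝ᵥ (B u).mulVec w = -(w ⬝ᵥ (B u).mulVec z) := by
    intro u w z
    rw [Matrix.dotProduct_mulVec, ← Matrix.mulVec_transpose, hBskew, Matrix.neg_mulVec,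
      neg_dotProduct, dotProduct_comm]
  have hzero : ∀ u w z, z ⬝ᵥ (B u).mulVec w = 0 := by
    intro u w z
    have h1 := hform u w z
    have h2 := hform z w u
    have h3 := hform w u z
    rw [hBsymm u z] at h1
    rw [hBsymm z w] at h2
    rw [hBsymm w u] at h3
    linarith
  have hBv : B v = 0 := by
    ext i j
    simpa using hzero v (Pi.single j 1) (Pi.single i 1)
  exact sub_eq_zero.1 hBv

theorem transpose_eq_neg_of_orthogonal [DecidableEq ι] {A : Matrix ι ι ℝ} (ho : Aᵀ * A = 1)
    (hs : A * A = -1) : Aᵀ = -A := by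
  have h : Aᵀ * (A * A) = A := by rw [← Matrix.mul_assoc, ho, Matrix.one_mul]
  rw [hs, Matrix.mul_neg, Matrix.mul_one] at h
  exact neg_eq_iff_eq_neg.1 h

/-- Matrices as continuous operators. -/
noncomputable def matrixToCLM [DecidableEq ι] : Matrix ι ι ℝ →L[ℝ] ((ι → ℝ) →L[ℝ] (ι → ℝ)) :=
  LinearMap.toContinuousLinearMap
    (LinearMap.toContinuousLinearMap.toLinearMap.comp (Matrix.toLin').toLinearMap)

variable [DecidableEq ι]

theorem matrixToCLM_apply (A : Matrix ι ι ℝ) (v : ι → ℝ) : matrixToCLM A v = A.mulVec v := rfl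

theorem matrixToCLM_mul (A B : Matrix ι ι ℝ) :
    matrixToCLM (A * B) = matrixToCLM A * matrixToCLM B := by
  ext1 v
  simp [matrixToCLM_apply, mul_apply_eq_comp]

theorem matrixToCLM_neg_one : matrixToCLM (-1 : Matrix ι ι ℝ) = -1 := by
  ext1 v
  simp [matrixToCLM_apply]

theorem matrixToCLM_injective : Function.Injective (matrixToCLM (ι := ι)) := by
  intro A B h
  exact Matrix.toLin'.injective (LinearMap.toContinuousLinearMap.injective h)

theorem isHermitianIntegrable_matrixToCLM {J : (ι → ℝ) → Matrix ι ι ℝ}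
    (hC1 : ContDiff ℝ 1 J) (horth : ∀ x, (J x)ᵀ * J x = 1) (hsq : ∀ x, J x * J x = -1)
    (hinteg : ∀ x v w, nijenhuis J x v w = 0) :
    IsHermitianIntegrable fun x => matrixToCLM (J x) where
  contDiff := (matrixToCLM (ι := ι)).contDiff.comp hC1
  sq x := by rw [← matrixToCLM_mul, hsq, matrixToCLM_neg_one]
  fderiv_apply x v := by
    have h1 : HasFDerivAt (fun x => matrixToCLM (J x)) (matrixToCLM.comp (fderiv ℝ J x)) x :=
      matrixToCLM.hasFDerivAt.comp x (hC1.differentiable one_ne_zero x).hasFDerivAt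
    rw [h1.fderiv, ContinuousLinearMap.comp_apply, ContinuousLinearMap.comp_apply,
      ← matrixToCLM_mul, matrixToCLM_apply,
      fderiv_mulVec_of_nijenhuis_eq_zero hC1
        (fun y => transpose_eq_neg_of_orthogonal (horth y) (hsq y)) hsq hinteg]

/-- Orthogonal complex structures on the plane are isolated. -/
theorem eq_of_norm_sub_lt_one {A B : Matrix (Fin 2) (Fin 2) ℝ} (hA : Aᵀ * A = 1)
    (hA2 : A * A = -1) (hB : Bᵀ * B = 1) (hB2 : B * B = -1) (h : ‖A - B‖ < 1) : A = B := by
  have key : ∀ {C : Matrix (Fin 2) (Fin 2) ℝ}, Cᵀ * C = 1 → C * C = -1 →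
      C 0 0 = 0 ∧ C 1 1 = 0 ∧ C 1 0 = -C 0 1 ∧ C 0 1 ^ 2 = 1 := by
    intro C hC hC2
    have ht := transpose_eq_neg_of_orthogonal hC hC2
    have h00 := congrFun (congrFun ht 0) 0
    have h11 := congrFun (congrFun ht 1) 1
    have h01 := congrFun (congrFun ht 0) 1
    have hs := congrFun (congrFun hC2 0) 0
    simp only [Matrix.transpose_apply, Matrix.neg_apply] at h00 h11 h01
    simp [Matrix.mul_apply, Fin.sum_univ_two] at hs
    have h0 : C 0 0 = 0 := by linarith
    refine ⟨h0, by linarith, h01, ?_⟩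
    rw [h0, h01] at hs
    linarith
  obtain ⟨a0, a1, a2, a3⟩ := key hA hA2
  obtain ⟨b0, b1, b2, b3⟩ := key hB hB2
  have hn := (Matrix.norm_entry_le_entrywise_sup_norm (A - B) (i := 0) (j := 1)).trans_lt h
  rw [Matrix.sub_apply, Real.norm_eq_abs, abs_lt] at hn
  have hab : A 0 1 = B 0 1 := by
    rcases sq_eq_sq_iff_eq_or_eq_neg.1 (a3.trans b3.symm) with h1 | h1
    · exact h1
    · nlinarith
  ext i j
  fin_cases i <;> fin_cases j <;> simp [a0, a1, a2, b0, b1, b2, hab]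

end MatrixFields

/-- **Liouville theorem for asymptotically constant orthogonal complex structures.**
If `J` is a `C¹` orthogonal complex structure on `ℝ^{2n}` (orthogonal, squaring to `-1`,
with vanishing Nijenhuis tensor) that is asymptotically constant, i.e.
`‖J(x) − J₀‖ → 0` as `‖x‖ → ∞` for some constant orthogonal complex structure `J₀`,
then `J` is constant equal to `J₀`. -/
theorem asymptotically_constant_OCS_is_constant (n : ℕ) (hn : 1 ≤ n)
    (J : (Fin (2 * n) → ℝ) → Matrix (Fin (2 * n)) (Fin (2 * n)) ℝ)
    (hC1 : ContDiff ℝ 1 J)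
    (horth : ∀ x, (J x)ᵀ * J x = 1)
    (hsq : ∀ x, J x * J x = -1)
    (hinteg : ∀ x v w, nijenhuis J x v w = 0)
    (J₀ : Matrix (Fin (2 * n)) (Fin (2 * n)) ℝ)
    (hJ₀o : J₀ᵀ * J₀ = 1) (hJ₀s : J₀ * J₀ = -1)
    (hasymp : Tendsto (fun x => ‖J x - J₀‖) (cocompact (Fin (2 * n) → ℝ)) (nhds 0)) :
    ∀ x, J x = J₀ := by
  have hK := isHermitianIntegrable_matrixToCLM hC1 horth hsq hinteg
  have hK₀ : matrixToCLM J₀ * matrixToCLM J₀ = -1 := by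
    rw [← matrixToCLM_mul, hJ₀s, matrixToCLM_neg_one]
  have : Nonempty (Fin (2 * n)) := ⟨⟨0, by omega⟩⟩
  have hev : ∀ᶠ x in cocompact (Fin (2 * n) → ℝ), matrixToCLM (J x) = matrixToCLM J₀ := by
    rcases hn.eq_or_lt with rfl | hn2
    · filter_upwards [hasymp.eventually (gt_mem_nhds one_pos)] with x hx
      exact congrArg _ (eq_of_norm_sub_lt_one (horth x) (hsq x) hJ₀o hJ₀s hx)
    · refine hK.eventually_eq hK₀ (by rw [Fintype.card_fin]; omega) ?_
      exact (matrixToCLM.continuous.tendsto J₀).comp (tendsto_iff_norm_sub_tendsto_zero.2 hasymp)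
  exact fun x => matrixToCLM_injective (hK.eq_of_eventually_eq hK₀ hev x)
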